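/- Suppose a morphism of frames α : 𝓕 → 𝓕' induces an isomorphism R ≅ R' and a surjection S → S' whose kernel 𝔞 ⊂ S is nilpotent and admits a filtration 𝔞 = 𝔞₀ ⊇ 𝔞₁ ⊇ … ⊇ 𝔞_n = 0 such that f(𝔞_i) ⊆ 𝔞_{i+1}, f₁(𝔞_i) ⊆ 𝔞_i, and f₁ is elementwise nilpotent on 𝔞_i/𝔞_{i+1} (for each a ∈ 𝔞_i there is m with f₁^m(a) ∈ 𝔞_{i+1}). Then α is crystalline, i.e., the base change functor α_* from windows over 𝓕 to windows over 𝓕' is an equivalence of categories. -/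

import Mathlib

open scoped BigOperators

/-- A frame `(S, I, R, f, f₁)` (with `R = S ⧸ I` implicit):
`S` is a local ring, `I ⊆ S` an ideal, `f` a ring endomorphism of `S`,
`f₁ : I → S` an `f`-linear map such that `f₁(I)` generates `S` as an `S`-module. -/
structure Frame (S : Type) [CommRing S] where
  isLocal : IsLocalRing S
  I : Ideal S
  f : S →+* S
  f₁ : I →ₛₗ[f] S
  span_f₁ : Ideal.span (Set.range ⇑f₁) = ⊤

/-- A window `(P, Q, F, F₁)` over a frame. -/
structure IsWindow {S : Type} [CommRing S] (𝓕 : Frame S)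
    {P : Type} [AddCommGroup P] [Module S P] [Module.Free S P] [Module.Finite S P]
    (Q : Submodule S P) (F : P →ₛₗ[𝓕.f] P) (F₁ : Q →ₛₗ[𝓕.f] P) : Prop where
  smul_le : 𝓕.I • (⊤ : Submodule S P) ≤ Q
  quot_free : ∃ n : ℕ, Nonempty ((P ⧸ Q) ≃ₗ[S] (Fin n → S ⧸ 𝓕.I))
  F₁_smul : ∀ (a : 𝓕.I) (x : P),
    F₁ ⟨(a : S) • x, smul_le (Submodule.smul_mem_smul a.2 Submodule.mem_top)⟩
      = 𝓕.f₁ a • F x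
  span_F₁ : Submodule.span S (Set.range ⇑F₁) = ⊤

/-- A bundled window over a frame. -/
structure Window {S : Type} [CommRing S] (𝓕 : Frame S) where
  P : Type
  [addCommGroup : AddCommGroup P]
  [module : Module S P]
  [free : Module.Free S P]
  [finite : Module.Finite S P]
  Q : Submodule S P
  F : P →ₛₗ[𝓕.f] P
  F₁ : Q →ₛₗ[𝓕.f] P
  isWindow : IsWindow 𝓕 Q F F₁

attribute [instance] Window.addCommGroup Window.module Window.free Window.finite

/-- A morphism of windows over a fixed frame. -/
structure WindowHom {S : Type} [CommRing S] {𝓕 : Frame S} (𝒳 𝒴 : Window 𝓕) where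
  g : 𝒳.P →ₗ[S] 𝒴.P
  mapQ : ∀ x ∈ 𝒳.Q, g x ∈ 𝒴.Q
  commF : ∀ x, 𝒴.F (g x) = g (𝒳.F x)
  commF₁ : ∀ (x : 𝒳.Q) (h : g x ∈ 𝒴.Q), 𝒴.F₁ ⟨g x, h⟩ = g (𝒳.F₁ x)

theorem WindowHom.ext' {S : Type} [CommRing S] {𝓕 : Frame S} {𝒳 𝒴 : Window 𝓕}
    {a b : WindowHom 𝒳 𝒴} (h : a.g = b.g) : a = b := by
  cases a; cases b; cases h; rfl

instance WindowCategory {S : Type} [CommRing S] (𝓕 : Frame S) :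
    CategoryTheory.Category (Window 𝓕) where
  Hom := WindowHom
  id 𝒳 := ⟨LinearMap.id, fun _ h => h, fun _ => rfl, fun x _ => by simp⟩
  comp {𝒳₁ 𝒳₂ 𝒳₃} a b :=
    ⟨b.g.comp a.g, fun x hx => b.mapQ _ (a.mapQ x hx),
     fun x => by simp [b.commF, a.commF],
     fun x h => by
       have h₂ : a.g x ∈ 𝒳₂.Q := a.mapQ _ x.2
       exact (b.commF₁ ⟨a.g x, h₂⟩ (by simpa using h)).trans
         (congrArg b.g (a.commF₁ x h₂))⟩
  id_comp _ := WindowHom.ext' rfl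
  comp_id _ := WindowHom.ext' rfl
  assoc _ _ _ := WindowHom.ext' rfl

/-- An `α`-morphism of windows, for a `u`-morphism of frames with underlying
ring homomorphism `α : S → S'`. -/
structure AlphaHom {S S' : Type} [CommRing S] [CommRing S'] {𝓕 : Frame S} {𝓕' : Frame S'}
    (u : S') (α : S →+* S') (𝒳 : Window 𝓕) (𝒴 : Window 𝓕') where
  g : 𝒳.P →ₛₗ[α] 𝒴.P
  mapQ : ∀ x ∈ 𝒳.Q, g x ∈ 𝒴.Q
  commF : ∀ x, 𝒴.F (g x) = g (𝒳.F x)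
  commF₁ : ∀ (x : 𝒳.Q) (h : g x ∈ 𝒴.Q), 𝒴.F₁ ⟨g x, h⟩ = u • g (𝒳.F₁ x)

/-- A `u`-morphism of frames `α : 𝓕 → 𝓕'`. A morphism of frames is a `1`-morphism. -/
structure IsFrameHom {S S' : Type} [CommRing S] [CommRing S'] (𝓕 : Frame S) (𝓕' : Frame S')
    (u : S') (α : S →+* S') : Prop where
  mapI : ∀ a ∈ 𝓕.I, α a ∈ 𝓕'.I
  commf : ∀ s, 𝓕'.f (α s) = α (𝓕.f s)
  commf₁ : ∀ (a : 𝓕.I) (h : α a ∈ 𝓕'.I), 𝓕'.f₁ ⟨α a, h⟩ = u * α (𝓕.f₁ a)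

/-- `α` is crystalline: the base change functor `α_*` (characterized on objects by
the universal property `Hom_α(𝒳, 𝒵) = Hom_{𝓕'}(α_*𝒳, 𝒵)` via a natural `α`-morphism
`𝒳 → α_*𝒳`) exists and is an equivalence of categories. -/
def IsCrystalline {S S' : Type} [CommRing S] [CommRing S'] (𝓕 : Frame S) (𝓕' : Frame S')
    (u : S') (α : S →+* S') : Prop :=
  ∃ (G : CategoryTheory.Functor (Window 𝓕) (Window 𝓕'))
    (ι : ∀ 𝒳 : Window 𝓕, AlphaHom u α 𝒳 (G.obj 𝒳)),
    (∀ (𝒳₁ 𝒳₂ : Window 𝓕) (h : 𝒳₁ ⟶ 𝒳₂) (x : 𝒳₁.P),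
        (G.map h).g ((ι 𝒳₁).g x) = (ι 𝒳₂).g (h.g x)) ∧
    (∀ (𝒳 : Window 𝓕) (𝒵 : Window 𝓕') (g : AlphaHom u α 𝒳 𝒵),
        ∃! h : G.obj 𝒳 ⟶ 𝒵, ∀ x, h.g ((ι 𝒳).g x) = g.g x) ∧
    G.IsEquivalence

theorem exists_semilinear_descend {S S' T M N K : Type*} [CommRing S] [CommRing S'] [CommRing T]
    [AddCommGroup M] [AddCommGroup N] [AddCommGroup K] [Module S M] [Module S' N] [Module T K]
    {α : S →+* S'} (hα : Function.Surjective α) (τ : S' →+* T)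
    (ι : M →ₛₗ[α] N) (hι : Function.Surjective ι) (φ : M → K)
    (hadd : ∀ x y, φ (x + y) = φ x + φ y) (hsmul : ∀ s x, φ (s • x) = τ (α s) • φ x)
    (hker : ∀ x, ι x = 0 → φ x = 0) :
    ∃ ψ : N →ₛₗ[τ] K, ∀ x, ψ (ι x) = φ x := by
  have key : ∀ x y, ι x = ι y → φ x = φ y := fun x y h => by
    have h1 : φ (x - y) = 0 := hker _ (by rw [map_sub, h, sub_self])
    have h2 := hadd (x - y) y
    rwa [sub_add_cancel, h1, zero_add] at h2
  refine ⟨{ toFun := fun n => φ (Function.surjInv hι n), map_add' := ?_, map_smul' := ?_ }, ?_⟩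
  · intro m n
    rw [← hadd]
    apply key
    simp only [map_add, Function.surjInv_eq]
  · intro s n
    obtain ⟨s, rfl⟩ := hα s
    rw [← hsmul]
    apply key
    simp only [map_smulₛₗ, Function.surjInv_eq]
  · intro x
    exact key _ _ (Function.surjInv_eq hι _)

namespace Frame

variable {S : Type} [CommRing S] (𝓕 : Frame S)

theorem exists_isUnit_f₁ : ∃ a : 𝓕.I, IsUnit (𝓕.f₁ a) := by
  have := 𝓕.isLocal
  by_contra! h
  have h1 : Ideal.span (Set.range ⇑𝓕.f₁) ≤ IsLocalRing.maximalIdeal S := by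
    rw [Ideal.span_le]
    rintro _ ⟨a, rfl⟩
    exact h a
  rw [𝓕.span_f₁] at h1
  exact (IsLocalRing.maximalIdeal.isMaximal S).ne_top (top_le_iff.mp h1)

theorem f_mul_f₁ (a b : 𝓕.I) : 𝓕.f a * 𝓕.f₁ b = 𝓕.f b * 𝓕.f₁ a := by
  have h1 := 𝓕.f₁.map_smulₛₗ (a : S) b
  have h2 := 𝓕.f₁.map_smulₛₗ (b : S) a
  rw [smul_eq_mul] at h1 h2
  rw [← h1, ← h2]
  congr 1
  ext
  simp [mul_comm]

theorem exists_f_eq_mul_f₁ : ∃ θ : S, ∀ a : 𝓕.I, 𝓕.f a = θ * 𝓕.f₁ a := by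
  obtain ⟨b, u, hu⟩ := 𝓕.exists_isUnit_f₁
  refine ⟨𝓕.f b * ↑u⁻¹, fun a => ?_⟩
  have := 𝓕.f_mul_f₁ a b
  rw [← hu] at this
  calc 𝓕.f a = (𝓕.f a * u) * ↑u⁻¹ := by rw [mul_assoc, Units.mul_inv, mul_one]
    _ = _ := by rw [this]; ring

open Classical in
/-- The map `f₁`, extended by zero outside of `I`. -/
noncomputable def f₁Ext (s : S) : S := if h : s ∈ 𝓕.I then 𝓕.f₁ ⟨s, h⟩ else 0

theorem f₁Ext_of_mem {s : S} (h : s ∈ 𝓕.I) : 𝓕.f₁Ext s = 𝓕.f₁ ⟨s, h⟩ := dif_pos h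

theorem f₁Ext_zero : 𝓕.f₁Ext 0 = 0 := by
  rw [𝓕.f₁Ext_of_mem (zero_mem _)]
  exact map_zero 𝓕.f₁

theorem iterate_f₁Ext_zero (m : ℕ) : 𝓕.f₁Ext^[m] 0 = 0 := by
  induction m with
  | zero => rfl
  | succ m ih => rw [Function.iterate_succ_apply, f₁Ext_zero, ih]

/-- An ideal contained in `I` that is stable under `f₁` and on which `f₁` is elementwise
nilpotent. -/
structure IsNilIdeal (K : Ideal S) : Prop where
  le : K ≤ 𝓕.I
  f₁_mem : ∀ a ∈ K, 𝓕.f₁Ext a ∈ K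
  nil : ∀ a ∈ K, ∃ m, 𝓕.f₁Ext^[m] a = 0

theorem isNilIdeal_of_filtration (𝔞 : ℕ → Ideal S) (hI : 𝔞 0 ≤ 𝓕.I)
    (hanti : ∀ i, 𝔞 (i + 1) ≤ 𝔞 i) (hfin : ∃ n : ℕ, 𝔞 n = ⊥)
    (hf₁ : ∀ i, ∀ a, ∀ h : a ∈ 𝓕.I, a ∈ 𝔞 i → 𝓕.f₁ ⟨a, h⟩ ∈ 𝔞 i)
    (hnil : ∀ i, ∀ c : ℕ → S, c 0 ∈ 𝔞 i →
      (∀ j, ∃ h : c j ∈ 𝓕.I, c (j + 1) = 𝓕.f₁ ⟨c j, h⟩) →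
      ∃ m, c m ∈ 𝔞 (i + 1)) : 𝓕.IsNilIdeal (𝔞 0) := by
  have hle : ∀ i, 𝔞 i ≤ 𝓕.I := fun i => (antitone_nat_of_succ_le hanti (Nat.zero_le i)).trans hI
  have hst : ∀ i, ∀ a ∈ 𝔞 i, 𝓕.f₁Ext a ∈ 𝔞 i := fun i a ha => by
    rw [𝓕.f₁Ext_of_mem (hle i ha)]
    exact hf₁ i a _ ha
  refine ⟨hI, hst 0, fun a ha => ?_⟩
  have key : ∀ i, ∃ m, 𝓕.f₁Ext^[m] a ∈ 𝔞 i := by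
    intro i
    induction i with
    | zero => exact ⟨0, ha⟩
    | succ i ih =>
      obtain ⟨m, hm⟩ := ih
      have hj : ∀ j, 𝓕.f₁Ext^[j] (𝓕.f₁Ext^[m] a) ∈ 𝔞 i := by
        intro j
        induction j with
        | zero => exact hm
        | succ j ih =>
          rw [Function.iterate_succ_apply']
          exact hst i _ ih
      obtain ⟨k, hk⟩ := hnil i (fun j => 𝓕.f₁Ext^[j] (𝓕.f₁Ext^[m] a)) hm fun j =>
        ⟨hle i (hj j), by
          rw [Function.iterate_succ_apply']
          exact 𝓕.f₁Ext_of_mem (hle i (hj j))⟩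
      refine ⟨k + m, ?_⟩
      rwa [Function.iterate_add_apply]
  obtain ⟨n, hn⟩ := hfin
  obtain ⟨m, hm⟩ := key n
  rw [hn] at hm
  exact ⟨m, hm⟩

end Frame

namespace Window

variable {S : Type} [CommRing S] {𝓕 : Frame S}

theorem smul_mem_Q (𝒳 : Window 𝓕) {a : S} (ha : a ∈ 𝓕.I) (x : 𝒳.P) : a • x ∈ 𝒳.Q :=
  𝒳.isWindow.smul_le (Submodule.smul_mem_smul ha Submodule.mem_top)

theorem F₁_smul (𝒳 : Window 𝓕) {a : S} (ha : a ∈ 𝓕.I) (x : 𝒳.P) (h : a • x ∈ 𝒳.Q) :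
    𝒳.F₁ ⟨a • x, h⟩ = 𝓕.f₁ ⟨a, ha⟩ • 𝒳.F x :=
  𝒳.isWindow.F₁_smul ⟨a, ha⟩ x

theorem F₁_add (𝒳 : Window 𝓕) {x y : 𝒳.P} (hx : x ∈ 𝒳.Q) (hy : y ∈ 𝒳.Q) (h : x + y ∈ 𝒳.Q) :
    𝒳.F₁ ⟨x + y, h⟩ = 𝒳.F₁ ⟨x, hx⟩ + 𝒳.F₁ ⟨y, hy⟩ :=
  𝒳.F₁.map_add ⟨x, hx⟩ ⟨y, hy⟩

theorem span_induction_F₁ (𝒳 : Window 𝓕) (N : Submodule S 𝒳.P)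
    (h : ∀ x (hx : x ∈ 𝒳.Q), 𝒳.F₁ ⟨x, hx⟩ ∈ N) (x : 𝒳.P) : x ∈ N := by
  have : (⊤ : Submodule S 𝒳.P) ≤ N := by
    rw [← 𝒳.isWindow.span_F₁, Submodule.span_le]
    rintro _ ⟨q, rfl⟩
    exact h _ q.2
  exact this Submodule.mem_top

theorem F₁_mem_smul_top (𝒳 : Window 𝓕) {J J' : Ideal S} (hJ : J ≤ 𝓕.I)
    (hJJ' : ∀ a ∈ J, 𝓕.f₁Ext a ∈ J') {x : 𝒳.P} (hx : x ∈ J • (⊤ : Submodule S 𝒳.P))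
    (hxQ : x ∈ 𝒳.Q) : 𝒳.F₁ ⟨x, hxQ⟩ ∈ J' • (⊤ : Submodule S 𝒳.P) := by
  suffices ∃ h : x ∈ 𝒳.Q, 𝒳.F₁ ⟨x, h⟩ ∈ J' • (⊤ : Submodule S 𝒳.P) from this.2
  clear hxQ
  induction hx using Submodule.smul_induction_on' with
  | smul a ha y _ =>
    refine ⟨𝒳.smul_mem_Q (hJ ha) y, ?_⟩
    rw [𝒳.F₁_smul (hJ ha), ← 𝓕.f₁Ext_of_mem]
    exact Submodule.smul_mem_smul (hJJ' a ha) Submodule.mem_top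
  | add x _ y _ hx hy =>
    obtain ⟨hx, hx'⟩ := hx
    obtain ⟨hy, hy'⟩ := hy
    refine ⟨add_mem hx hy, ?_⟩
    rw [𝒳.F₁_add hx hy]
    exact add_mem hx' hy'

/-- A normal decomposition of a window: a basis of `P` adapted to `Q`. -/
structure NormalDecomposition (𝒳 : Window 𝓕) where
  r : ℕ
  s : ℕ
  e : Module.Basis (Fin r ⊕ Fin s) S 𝒳.P
  mem_iff : ∀ x, x ∈ 𝒳.Q ↔ ∀ j, e.repr x (Sum.inr j) ∈ 𝓕.I

theorem exists_linearMap_mem_Q_iff (𝒳 : Window 𝓕) :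
    ∃ (s : ℕ) (p : 𝒳.P →ₗ[S] (Fin s → S)), Function.Surjective p ∧
      ∀ x, x ∈ 𝒳.Q ↔ ∀ j, p x j ∈ 𝓕.I := by
  have := 𝓕.isLocal
  by_cases hI : 𝓕.I = ⊤
  · refine ⟨0, 0, fun y => ⟨0, Subsingleton.elim _ _⟩, fun x => ?_⟩
    simp only [IsEmpty.forall_iff, iff_true]
    have := 𝒳.smul_mem_Q (a := 1) (hI ▸ Submodule.mem_top) x
    rwa [one_smul] at this
  · obtain ⟨s, ⟨E⟩⟩ := 𝒳.isWindow.quot_free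
    let q : (Fin s → S) →ₗ[S] (Fin s → S ⧸ 𝓕.I) :=
      LinearMap.pi fun j => 𝓕.I.mkQ.comp (LinearMap.proj j)
    have hq : Function.Surjective q := fun y => by
      choose x hx using fun j => Submodule.mkQ_surjective 𝓕.I (y j)
      exact ⟨x, funext hx⟩
    obtain ⟨p, hp⟩ := Module.projective_lifting_property q
      (E.toLinearMap.comp 𝒳.Q.mkQ) hq
    have hp' : ∀ x, q (p x) = E (𝒳.Q.mkQ x) := fun x => LinearMap.congr_fun hp x
    have hqk : ∀ v, q v = 0 ↔ ∀ j, v j ∈ 𝓕.I := fun v => by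
      rw [funext_iff]
      refine forall_congr' fun j => ?_
      exact Submodule.Quotient.mk_eq_zero _
    refine ⟨s, p, ?_, fun x => ?_⟩
    · rw [← LinearMap.range_eq_top, ← top_le_iff]
      refine Submodule.le_of_le_smul_of_le_jacobson_bot (I := 𝓕.I) Module.Finite.fg_top ?_ ?_
      · rw [IsLocalRing.jacobson_eq_maximalIdeal _ bot_ne_top]
        exact IsLocalRing.le_maximalIdeal hI
      · intro v _
        obtain ⟨x, hx⟩ := 𝒳.Q.mkQ_surjective (E.symm (q v))
        have h1 : q (v - p x) = 0 := by
          rw [map_sub, hp', hx, LinearEquiv.apply_symm_apply, sub_self]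
        rw [hqk] at h1
        have h2 : v = p x + (v - p x) := by abel
        rw [h2]
        refine Submodule.add_mem_sup ⟨x, rfl⟩ ?_
        rw [pi_eq_sum_univ' (v - p x)]
        exact Submodule.sum_mem _ fun j _ => Submodule.smul_mem_smul (h1 j) Submodule.mem_top
    · rw [← hqk, hp', LinearEquiv.map_eq_zero_iff, Submodule.mkQ_apply,
        Submodule.Quotient.mk_eq_zero]

theorem nonempty_normalDecomposition (𝒳 : Window 𝓕) : Nonempty 𝒳.NormalDecomposition := by
  have := 𝓕.isLocal
  obtain ⟨s, p, hp, hQ⟩ := 𝒳.exists_linearMap_mem_Q_iff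
  obtain ⟨l, hl⟩ := Module.projective_lifting_property p LinearMap.id hp
  let E := Function.Exact.splitSurjectiveEquiv (f := (LinearMap.ker p).subtype) (g := p)
    (by intro x; simp) (Submodule.subtype_injective _) ⟨l, hl⟩
  have hE : ∀ x, (E.1 x).2 = p x := fun x => (LinearMap.congr_fun E.2.2 x).symm
  have : Module.Projective S (LinearMap.ker p) :=
    Module.Projective.of_split
      (E.1.symm.toLinearMap.comp (LinearMap.inl S (LinearMap.ker p) (Fin s → S)))
      ((LinearMap.fst S (LinearMap.ker p) (Fin s → S)).comp E.1.toLinearMap) (by ext; simp)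
  have : Module.Finite S (LinearMap.ker p) :=
    Module.Finite.of_surjective ((LinearMap.fst S _ (Fin s → S)).comp E.1.toLinearMap)
      ((LinearMap.fst_surjective (R := S) (M₂ := Fin s → S)).comp E.1.surjective)
  have : Module.Free S (LinearMap.ker p) := Module.free_of_flat_of_isLocalRing
  let b := Module.finBasis S (LinearMap.ker p)
  refine ⟨⟨_, s, (b.prod (Pi.basisFun S (Fin s))).map E.1.symm, fun x => ?_⟩⟩
  rw [hQ]
  refine forall_congr' fun j => ?_
  rw [Module.Basis.map_repr]
  simp [hE]

namespace NormalDecomposition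

variable {𝒳 : Window 𝓕} (N : 𝒳.NormalDecomposition)

theorem inl_mem (i : Fin N.r) : N.e (Sum.inl i) ∈ 𝒳.Q := by
  rw [N.mem_iff]
  intro j
  simp

theorem sum_repr (x : 𝒳.P) :
    x = ∑ i, N.e.repr x (Sum.inl i) • N.e (Sum.inl i)
      + ∑ j, N.e.repr x (Sum.inr j) • N.e (Sum.inr j) := by
  conv_lhs => rw [← N.e.sum_repr x]
  rw [Fintype.sum_sum_type]

/-- The images of the adapted basis under `F₁` and `F`. -/
noncomputable def c : Fin N.r ⊕ Fin N.s → 𝒳.P :=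
  Sum.elim (fun i => 𝒳.F₁ ⟨N.e (Sum.inl i), N.inl_mem i⟩) (fun j => 𝒳.F (N.e (Sum.inr j)))

theorem F₁_eq_sum (x : 𝒳.P) (hx : x ∈ 𝒳.Q) :
    𝒳.F₁ ⟨x, hx⟩ = ∑ i, 𝓕.f (N.e.repr x (Sum.inl i)) • 𝒳.F₁ ⟨N.e (Sum.inl i), N.inl_mem i⟩
      + ∑ j, 𝓕.f₁ ⟨N.e.repr x (Sum.inr j), (N.mem_iff x).1 hx j⟩ • 𝒳.F (N.e (Sum.inr j)) := by
  have h : (⟨x, hx⟩ : 𝒳.Q) = ∑ i, N.e.repr x (Sum.inl i) • ⟨N.e (Sum.inl i), N.inl_mem i⟩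
      + ∑ j, ⟨N.e.repr x (Sum.inr j) • N.e (Sum.inr j),
          𝒳.smul_mem_Q ((N.mem_iff x).1 hx j) _⟩ := by
    ext
    simpa using N.sum_repr x
  rw [h, map_add, map_sum, map_sum]
  congr 1
  · exact Finset.sum_congr rfl fun i _ => 𝒳.F₁.map_smulₛₗ _ _
  · exact Finset.sum_congr rfl fun j _ => 𝒳.F₁_smul _ _ _

theorem F_eq_sum {θ : S} (hθ : ∀ a : 𝓕.I, 𝓕.f a = θ * 𝓕.f₁ a) (x : 𝒳.P) :
    𝒳.F x = ∑ i, (𝓕.f (N.e.repr x (Sum.inl i)) * θ) • 𝒳.F₁ ⟨N.e (Sum.inl i), N.inl_mem i⟩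
      + ∑ j, 𝓕.f (N.e.repr x (Sum.inr j)) • 𝒳.F (N.e (Sum.inr j)) := by
  have hF : ∀ y (hy : y ∈ 𝒳.Q), 𝒳.F y = θ • 𝒳.F₁ ⟨y, hy⟩ := fun y hy => by
    obtain ⟨a, u, hu⟩ := 𝓕.exists_isUnit_f₁
    have h1 : 𝒳.F₁ ⟨(a : S) • y, 𝒳.smul_mem_Q a.2 y⟩ = 𝓕.f₁ a • 𝒳.F y := 𝒳.F₁_smul a.2 y _
    have h2 : 𝒳.F₁ ⟨(a : S) • y, 𝒳.smul_mem_Q a.2 y⟩ = 𝓕.f a • 𝒳.F₁ ⟨y, hy⟩ :=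
      𝒳.F₁.map_smulₛₗ (a : S) ⟨y, hy⟩
    rw [h1, hθ, mul_comm, mul_smul, ← hu] at h2
    exact u.isUnit.smul_left_cancel.1 h2
  conv_lhs => rw [N.sum_repr x]
  rw [map_add, map_sum, map_sum]
  congr 1
  · refine Finset.sum_congr rfl fun i _ => ?_
    rw [map_smulₛₗ, hF _ (N.inl_mem i), smul_smul]
  · exact Finset.sum_congr rfl fun j _ => map_smulₛₗ _ _ _

theorem span_c : Submodule.span S (Set.range N.c) = ⊤ := by
  refine top_le_iff.1 fun x _ => 𝒳.span_induction_F₁ _ (fun x hx => ?_) x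
  rw [N.F₁_eq_sum]
  refine add_mem (Submodule.sum_mem _ fun i _ => Submodule.smul_mem _ _ ?_)
    (Submodule.sum_mem _ fun j _ => Submodule.smul_mem _ _ ?_)
  · exact Submodule.subset_span ⟨Sum.inl i, rfl⟩
  · exact Submodule.subset_span ⟨Sum.inr j, rfl⟩

theorem exists_basis_eq_c : ∃ b : Module.Basis (Fin N.r ⊕ Fin N.s) S 𝒳.P, ∀ k, b k = N.c k := by
  let φ : 𝒳.P →ₗ[S] 𝒳.P := N.e.constr S N.c
  have hs : Function.Surjective φ := by
    rw [← LinearMap.range_eq_top, Module.Basis.constr_range]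
    exact N.span_c
  refine ⟨N.e.map (LinearEquiv.ofBijective φ
    ⟨OrzechProperty.injective_of_surjective_endomorphism φ hs, hs⟩), fun k => ?_⟩
  rw [Module.Basis.map_apply]
  exact N.e.constr_basis S N.c k

end NormalDecomposition

/-- `h` is the linear map induced by `g` via the operators of the windows `𝒳` and `𝒴`. -/
structure IsTwist {𝒳 𝒴 : Window 𝓕} (g h : 𝒳.P →ₗ[S] 𝒴.P) : Prop where
  mapQ : ∀ x ∈ 𝒳.Q, g x ∈ 𝒴.Q
  commF : ∀ x, 𝒴.F (g x) = h (𝒳.F x)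
  commF₁ : ∀ x (hx : x ∈ 𝒳.Q) (hy : g x ∈ 𝒴.Q), 𝒴.F₁ ⟨g x, hy⟩ = h (𝒳.F₁ ⟨x, hx⟩)

theorem exists_isTwist {𝒳 𝒴 : Window 𝓕} (g : 𝒳.P →ₗ[S] 𝒴.P) (hg : ∀ x ∈ 𝒳.Q, g x ∈ 𝒴.Q) :
    ∃ h, IsTwist g h := by
  obtain ⟨N⟩ := 𝒳.nonempty_normalDecomposition
  obtain ⟨b, hb⟩ := N.exists_basis_eq_c
  let h : 𝒳.P →ₗ[S] 𝒴.P := b.constr S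
    (Sum.elim (fun i => 𝒴.F₁ ⟨g (N.e (Sum.inl i)), hg _ (N.inl_mem i)⟩)
      (fun j => 𝒴.F (g (N.e (Sum.inr j)))))
  have hl : ∀ i, h (𝒳.F₁ ⟨N.e (Sum.inl i), N.inl_mem i⟩)
      = 𝒴.F₁ ⟨g (N.e (Sum.inl i)), hg _ (N.inl_mem i)⟩ := fun i => by
    have := b.constr_basis S (Sum.elim (fun i => 𝒴.F₁ ⟨g (N.e (Sum.inl i)), hg _ (N.inl_mem i)⟩)
      (fun j => 𝒴.F (g (N.e (Sum.inr j))))) (Sum.inl i)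
    rwa [hb] at this
  have hr : ∀ j, h (𝒳.F (N.e (Sum.inr j))) = 𝒴.F (g (N.e (Sum.inr j))) := fun j => by
    have := b.constr_basis S (Sum.elim (fun i => 𝒴.F₁ ⟨g (N.e (Sum.inl i)), hg _ (N.inl_mem i)⟩)
      (fun j => 𝒴.F (g (N.e (Sum.inr j))))) (Sum.inr j)
    rwa [hb] at this
  have h₁ : ∀ x (hx : x ∈ 𝒳.Q) (hy : g x ∈ 𝒴.Q), 𝒴.F₁ ⟨g x, hy⟩ = h (𝒳.F₁ ⟨x, hx⟩) := by
    intro x hx hy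
    have hx' : (⟨g x, hy⟩ : 𝒴.Q) =
        ∑ i, N.e.repr x (Sum.inl i) • ⟨g (N.e (Sum.inl i)), hg _ (N.inl_mem i)⟩
        + ∑ j, ⟨N.e.repr x (Sum.inr j) • g (N.e (Sum.inr j)),
          𝒴.smul_mem_Q ((N.mem_iff x).1 hx j) _⟩ := by
      ext
      simpa using congrArg g (N.sum_repr x)
    rw [hx', N.F₁_eq_sum x hx, map_add, map_add, map_sum, map_sum, map_sum, map_sum]
    congr 1
    · refine Finset.sum_congr rfl fun i _ => ?_
      rw [map_smul h, hl]
      exact 𝒴.F₁.map_smulₛₗ _ _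
    · refine Finset.sum_congr rfl fun j _ => ?_
      rw [map_smul h, hr]
      exact 𝒴.F₁_smul _ _ _
  refine ⟨h, hg, fun x => ?_, h₁⟩
  obtain ⟨a, u, hu⟩ := 𝓕.exists_isUnit_f₁
  have h1 : 𝒳.F₁ ⟨(a : S) • x, 𝒳.smul_mem_Q a.2 x⟩ = 𝓕.f₁ a • 𝒳.F x := 𝒳.F₁_smul a.2 x _
  have h2 : 𝒴.F₁ ⟨(a : S) • g x, 𝒴.smul_mem_Q a.2 _⟩ = 𝓕.f₁ a • 𝒴.F (g x) :=
    𝒴.F₁_smul a.2 _ _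
  have h3 := h₁ _ (𝒳.smul_mem_Q a.2 x) (hg _ (𝒳.smul_mem_Q a.2 x))
  simp only [map_smul] at h3
  rw [h1, h2, map_smul, ← hu] at h3
  exact u.isUnit.smul_left_cancel.1 h3

namespace IsTwist

variable {𝒳 𝒴 : Window 𝓕} {g g' h h' : 𝒳.P →ₗ[S] 𝒴.P}

theorem add (H : IsTwist g h) (H' : IsTwist g' h') : IsTwist (g + g') (h + h') where
  mapQ x hx := add_mem (H.mapQ x hx) (H'.mapQ x hx)
  commF x := by simp [H.commF, H'.commF]
  commF₁ x hx hy := by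
    have h1 := 𝒴.F₁_add (H.mapQ x hx) (H'.mapQ x hx) hy
    rw [H.commF₁ x hx, H'.commF₁ x hx] at h1
    exact h1

theorem neg (H : IsTwist g h) : IsTwist (-g) (-h) where
  mapQ x hx := neg_mem (H.mapQ x hx)
  commF x := by simp [H.commF]
  commF₁ x hx hy := by
    have h1 := 𝒴.F₁.map_neg ⟨g x, H.mapQ x hx⟩
    rw [H.commF₁ x hx] at h1
    exact h1

theorem zero : IsTwist (0 : 𝒳.P →ₗ[S] 𝒴.P) 0 where
  mapQ _ _ := zero_mem _
  commF x := by simp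
  commF₁ x hx hy := 𝒴.F₁.map_zero

theorem sum {w v : ℕ → 𝒳.P →ₗ[S] 𝒴.P} (H : ∀ k, IsTwist (w k) (v k)) (m : ℕ) :
    IsTwist (∑ k ∈ Finset.range m, w k) (∑ k ∈ Finset.range m, v k) := by
  induction m with
  | zero => simpa using zero
  | succ m ih =>
    rw [Finset.sum_range_succ, Finset.sum_range_succ]
    exact ih.add (H m)

theorem mem_smul_top (H : IsTwist g h) {J J' : Ideal S} (hJ : J ≤ 𝓕.I)
    (hJJ' : ∀ a ∈ J, 𝓕.f₁Ext a ∈ J') (hg : ∀ x, g x ∈ J • (⊤ : Submodule S 𝒴.P)) (x : 𝒳.P) :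
    h x ∈ J' • (⊤ : Submodule S 𝒴.P) := by
  refine 𝒳.span_induction_F₁ ((J' • (⊤ : Submodule S 𝒴.P)).comap h) (fun x hx => ?_) x
  rw [Submodule.mem_comap, ← H.commF₁ x hx (H.mapQ x hx)]
  exact 𝒴.F₁_mem_smul_top hJ hJJ' (hg x) _

end IsTwist

theorem f₁Ext_mem_span_image {a : S} {A : Set S} (hA : A ⊆ 𝓕.I) (ha : a ∈ Ideal.span A) :
    𝓕.f₁Ext a ∈ Ideal.span (𝓕.f₁Ext '' A) := by
  suffices ∃ h : a ∈ 𝓕.I, 𝓕.f₁ ⟨a, h⟩ ∈ Ideal.span (𝓕.f₁Ext '' A) by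
    obtain ⟨h, h'⟩ := this
    rwa [𝓕.f₁Ext_of_mem h]
  induction ha using Submodule.span_induction with
  | mem x hx =>
    refine ⟨hA hx, ?_⟩
    rw [← 𝓕.f₁Ext_of_mem]
    exact Ideal.subset_span ⟨x, hx, rfl⟩
  | zero =>
    refine ⟨zero_mem _, ?_⟩
    convert zero_mem (Ideal.span (𝓕.f₁Ext '' A))
    exact 𝓕.f₁.map_zero
  | add x y _ _ hx hy =>
    obtain ⟨hx, hx'⟩ := hx
    obtain ⟨hy, hy'⟩ := hy
    refine ⟨add_mem hx hy, ?_⟩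
    have := 𝓕.f₁.map_add ⟨x, hx⟩ ⟨y, hy⟩
    exact (congrArg (· ∈ Ideal.span (𝓕.f₁Ext '' A)) this).mpr (add_mem hx' hy')
  | smul s x _ hx =>
    obtain ⟨hx, hx'⟩ := hx
    refine ⟨Ideal.mul_mem_left _ s hx, ?_⟩
    have := 𝓕.f₁.map_smulₛₗ s ⟨x, hx⟩
    exact (congrArg (· ∈ Ideal.span (𝓕.f₁Ext '' A)) this).mpr (Ideal.mul_mem_left _ _ hx')

theorem exists_eq_zero_of_isTwist {𝒳 𝒴 : Window 𝓕} {K : Ideal S} (hK : 𝓕.IsNilIdeal K)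
    (w : ℕ → 𝒳.P →ₗ[S] 𝒴.P) (hw : ∀ k, IsTwist (w k) (w (k + 1)))
    (h0 : ∀ x, w 0 x ∈ K • (⊤ : Submodule S 𝒴.P)) : ∃ m, w m = 0 := by
  have := 𝓕.isLocal
  let b := Module.finBasis S 𝒳.P
  let d := Module.finBasis S 𝒴.P
  let a := fun p : Fin (Module.finrank S 𝒳.P) × Fin (Module.finrank S 𝒴.P) =>
    d.repr (w 0 (b p.1)) p.2
  have ha : ∀ p, a p ∈ K := fun p => by
    have h1 : ∀ y ∈ K • (⊤ : Submodule S 𝒴.P), ∀ j, d.repr y j ∈ K := fun y hy j => by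
      induction hy using Submodule.smul_induction_on' with
      | smul s hs y _ => simpa using Ideal.mul_mem_right _ _ hs
      | add x _ y _ hx hy => simpa using add_mem hx hy
    exact h1 _ (h0 _) _
  let A : ℕ → Set S := fun m => Set.range fun p => 𝓕.f₁Ext^[m] (a p)
  have hAK : ∀ m, A m ⊆ K := fun m => by
    induction m with
    | zero =>
      rintro _ ⟨p, rfl⟩
      exact ha p
    | succ m ih =>
      rintro _ ⟨p, rfl⟩
      simp only [Function.iterate_succ_apply']
      exact hK.f₁_mem _ (ih ⟨p, rfl⟩)
  have hA : ∀ m x, w m x ∈ Ideal.span (A m) • (⊤ : Submodule S 𝒴.P) := fun m => by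
    induction m with
    | zero =>
      intro x
      rw [← b.sum_repr x, map_sum]
      refine Submodule.sum_mem _ fun i _ => ?_
      rw [map_smul, ← d.sum_repr (w 0 (b i))]
      refine Submodule.smul_mem _ _ (Submodule.sum_mem _ fun j _ => ?_)
      exact Submodule.smul_mem_smul (Ideal.subset_span ⟨(i, j), rfl⟩) Submodule.mem_top
    | succ m ih =>
      refine (hw m).mem_smul_top (Ideal.span_le.2 ((hAK m).trans hK.le)) (fun s hs => ?_) ih
      have := f₁Ext_mem_span_image ((hAK m).trans hK.le) hs
      convert this using 2
      simp only [A, ← Set.range_comp, Function.comp_def, Function.iterate_succ_apply']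
  choose n hn using fun p => hK.nil (a p) (ha p)
  refine ⟨∑ p, n p, ?_⟩
  have hz : Ideal.span (A (∑ p, n p)) = ⊥ := by
    rw [Ideal.span_eq_bot]
    rintro _ ⟨p, rfl⟩
    have hle : n p ≤ ∑ p, n p := Finset.single_le_sum (fun _ _ => Nat.zero_le _) (Finset.mem_univ p)
    simp only
    rw [← Nat.sub_add_cancel hle, Function.iterate_add_apply, hn, 𝓕.iterate_f₁Ext_zero]
  ext x
  have := hA (∑ p, n p) x
  rw [hz, Submodule.bot_smul] at this
  exact this

theorem eq_zero_of_isTwist_self {𝒳 𝒴 : Window 𝓕} {K : Ideal S} (hK : 𝓕.IsNilIdeal K)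
    {g : 𝒳.P →ₗ[S] 𝒴.P} (hg : IsTwist g g) (h : ∀ x, g x ∈ K • (⊤ : Submodule S 𝒴.P)) :
    g = 0 :=
  (exists_eq_zero_of_isTwist hK (fun _ => g) (fun _ => hg) h).choose_spec

theorem exists_isTwist_sub_eq {𝒳 𝒴 : Window 𝓕} {K : Ideal S} (hK : 𝓕.IsNilIdeal K)
    (η : 𝒳.P →ₗ[S] 𝒴.P) (hη : ∀ x, η x ∈ K • (⊤ : Submodule S 𝒴.P)) :
    ∃ g h, IsTwist g h ∧ g - h = η ∧ ∀ x, g x ∈ K • (⊤ : Submodule S 𝒴.P) := by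
  have hQ : K • (⊤ : Submodule S 𝒴.P) ≤ 𝒴.Q :=
    (Submodule.smul_mono_left hK.le).trans 𝒴.isWindow.smul_le
  have step : ∀ g : {g : 𝒳.P →ₗ[S] 𝒴.P // ∀ x, g x ∈ K • (⊤ : Submodule S 𝒴.P)},
      ∃ h : {g : 𝒳.P →ₗ[S] 𝒴.P // ∀ x, g x ∈ K • (⊤ : Submodule S 𝒴.P)},
        IsTwist g.1 h.1 := fun g => by
    obtain ⟨h, hh⟩ := exists_isTwist g.1 fun x _ => hQ (g.2 x)
    exact ⟨⟨h, hh.mem_smul_top hK.le hK.f₁_mem g.2⟩, hh⟩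
  choose u hu using step
  let w := fun k => u^[k] ⟨η, hη⟩
  have hw : ∀ k, IsTwist (w k).1 (w (k + 1)).1 := fun k => by
    simp only [w, Function.iterate_succ_apply']
    exact hu _
  obtain ⟨m, hm⟩ := exists_eq_zero_of_isTwist hK (fun k => (w k).1) hw hη
  refine ⟨_, _, IsTwist.sum hw m, ?_, fun x => ?_⟩
  · rw [← Finset.sum_sub_distrib, Finset.sum_range_sub', hm, sub_zero]
    rfl
  · rw [LinearMap.sum_apply]
    exact Submodule.sum_mem _ fun k _ => (w k).2 x

end Window

/-- The intrinsic characterization of the morphism `𝒳 → α_* 𝒳` for surjective `α`. -/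
structure AlphaHom.IsBaseChange {S S' : Type} [CommRing S] [CommRing S'] {𝓕 : Frame S}
    {𝓕' : Frame S'} {α : S →+* S'} {𝒳 : Window 𝓕} {𝒴 : Window 𝓕'} (ι : AlphaHom 1 α 𝒳 𝒴) :
    Prop where
  surj : Function.Surjective ι.g
  surjQ : ∀ y ∈ 𝒴.Q, ∃ x ∈ 𝒳.Q, ι.g x = y
  ker : ∀ x, ι.g x = 0 → x ∈ RingHom.ker α • (⊤ : Submodule S 𝒳.P)

section BaseChange

variable {S S' : Type} [CommRing S] [CommRing S'] {𝓕 : Frame S} {𝓕' : Frame S'} {α : S →+* S'}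

theorem semilinear_eq_zero_of_mem_ker_smul {M N : Type*} [AddCommGroup M] [AddCommGroup N]
    [Module S M] [Module S' N] (ι : M →ₛₗ[α] N) {x : M}
    (hx : x ∈ RingHom.ker α • (⊤ : Submodule S M)) : ι x = 0 := by
  induction hx using Submodule.smul_induction_on' with
  | smul a ha y _ => rw [map_smulₛₗ, RingHom.mem_ker.1 ha, zero_smul]
  | add x _ y _ hx hy => rw [map_add, hx, hy, add_zero]

namespace AlphaHom.IsBaseChange

variable {𝒳 𝒴 : Window 𝓕} {𝒳' 𝒴' 𝒵 : Window 𝓕'} {ι : AlphaHom 1 α 𝒳 𝒳'}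
  {κ : AlphaHom 1 α 𝒴 𝒴'}

theorem hom_ext (hι : ι.IsBaseChange) {g h : WindowHom 𝒳' 𝒵}
    (H : ∀ x, g.g (ι.g x) = h.g (ι.g x)) : g = h := by
  refine WindowHom.ext' (LinearMap.ext fun y => ?_)
  obtain ⟨x, rfl⟩ := hι.surj y
  exact H x

theorem existsUnique_hom (hα : Function.Surjective α) (hι : ι.IsBaseChange)
    (g : AlphaHom 1 α 𝒳 𝒵) : ∃! h : WindowHom 𝒳' 𝒵, ∀ x, h.g (ι.g x) = g.g x := by
  obtain ⟨ψ, hψ⟩ := exists_semilinear_descend hα (RingHom.id S') ι.g hι.surj g.g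
    (map_add _) (fun s x => by simp)
    (fun x hx => semilinear_eq_zero_of_mem_ker_smul g.g (hι.ker x hx))
  refine ⟨⟨ψ, fun y hy => ?_, fun y => ?_, fun y hy => ?_⟩, hψ, fun h hh => hι.hom_ext fun x => ?_⟩
  · obtain ⟨x, hx, rfl⟩ := hι.surjQ y hy
    rw [hψ]
    exact g.mapQ x hx
  · obtain ⟨x, rfl⟩ := hι.surj y
    rw [hψ, g.commF, ι.commF, hψ]
  · obtain ⟨y, hyQ⟩ := y
    obtain ⟨x, hx, rfl⟩ := hι.surjQ y hyQ
    have h1 := ι.commF₁ ⟨x, hx⟩ hyQ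
    rw [one_smul] at h1
    have h2 := g.commF₁ ⟨x, hx⟩ (g.mapQ x hx)
    rw [one_smul] at h2
    refine Eq.trans ?_ (h2.trans ((hψ _).symm.trans (congrArg ψ h1.symm)))
    congr 1
    exact Subtype.ext (hψ x)
  · exact (hh x).trans (hψ x).symm

theorem existsUnique_lift (hK : 𝓕.IsNilIdeal (RingHom.ker α))
    (hκ : κ.IsBaseChange) (g' : WindowHom 𝒳' 𝒴') :
    ∃! g : WindowHom 𝒳 𝒴, ∀ x, g'.g (ι.g x) = κ.g (g.g x) := by
  refine existsUnique_of_exists_of_unique ?_ ?_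
  · obtain ⟨N⟩ := 𝒳.nonempty_normalDecomposition
    choose l hlQ hl using fun i => hκ.surjQ _ (g'.mapQ _ (ι.mapQ _ (N.inl_mem i)))
    choose t ht using fun j => hκ.surj (g'.g (ι.g (N.e (Sum.inr j))))
    let g₀ : 𝒳.P →ₗ[S] 𝒴.P := N.e.constr S (Sum.elim l t)
    have hgl : ∀ i, g₀ (N.e (Sum.inl i)) = l i := fun i => N.e.constr_basis S _ _
    have hgt : ∀ j, g₀ (N.e (Sum.inr j)) = t j := fun j => N.e.constr_basis S _ _
    have hg : ∀ x, g'.g (ι.g x) = κ.g (g₀ x) := fun x => by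
      rw [N.sum_repr x]
      simp only [map_add, map_sum, map_smulₛₗ, RingHom.id_apply, hgl, hgt, hl, ht]
    have hgQ : ∀ x ∈ 𝒳.Q, g₀ x ∈ 𝒴.Q := fun x hx => by
      rw [N.sum_repr x]
      simp only [map_add, map_sum, map_smul, hgl, hgt]
      exact add_mem (Submodule.sum_mem _ fun i _ => Submodule.smul_mem _ _ (hlQ i))
        (Submodule.sum_mem _ fun j _ => 𝒴.smul_mem_Q ((N.mem_iff x).1 hx j) _)
    obtain ⟨h₀, hh₀⟩ := Window.exists_isTwist g₀ hgQ
    have hκz : ∀ z, κ.g (h₀ z) = κ.g (g₀ z) := fun z => by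
      have hz : z ∈ Submodule.span S (Set.range 𝒳.F₁) := by
        rw [𝒳.isWindow.span_F₁]
        exact Submodule.mem_top
      induction hz using Submodule.span_induction with
      | mem z hz =>
        obtain ⟨⟨x, hx⟩, rfl⟩ := hz
        have e1 := κ.commF₁ ⟨g₀ x, hgQ x hx⟩ (κ.mapQ _ (hgQ x hx))
        have e2 := ι.commF₁ ⟨x, hx⟩ (ι.mapQ x hx)
        have e3 := g'.commF₁ ⟨ι.g x, ι.mapQ x hx⟩ (g'.mapQ _ (ι.mapQ x hx))
        rw [one_smul] at e1 e2
        rw [← hh₀.commF₁ x hx (hgQ x hx), ← e1, ← hg (𝒳.F₁ ⟨x, hx⟩), ← e2, ← e3]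
        congr 1
        exact Subtype.ext (hg x).symm
      | zero => simp
      | add x y _ _ hx hy => simp only [map_add, hx, hy]
      | smul s x _ hx => simp only [map_smul, map_smulₛₗ, hx]
    obtain ⟨ω, h, hωh, hη, hω⟩ := Window.exists_isTwist_sub_eq hK (h₀ - g₀) fun z =>
      hκ.ker _ (by rw [LinearMap.sub_apply, map_sub, hκz, sub_self])
    have hself : Window.IsTwist (g₀ + ω) (g₀ + ω) := by
      have h1 := hh₀.add hωh
      have h2 : h₀ + h = g₀ + ω := by
        rw [sub_eq_iff_eq_add.1 hη]
        abel
      rwa [h2] at h1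
    refine ⟨⟨g₀ + ω, hself.mapQ, hself.commF, fun x => hself.commF₁ x x.2⟩, fun x => ?_⟩
    rw [LinearMap.add_apply, map_add, semilinear_eq_zero_of_mem_ker_smul κ.g (hω x), add_zero, hg]
  · intro g h hg hh
    have tw : ∀ g : WindowHom 𝒳 𝒴, Window.IsTwist g.g g.g := fun g =>
      ⟨g.mapQ, g.commF, fun x hx => g.commF₁ ⟨x, hx⟩⟩
    have := Window.eq_zero_of_isTwist_self hK ((tw g).add (tw h).neg) fun x => hκ.ker _ (by
      rw [LinearMap.add_apply, LinearMap.neg_apply, map_add, map_neg, ← hg, ← hh, add_neg_cancel])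
    exact WindowHom.ext' (add_neg_eq_zero.1 this)

end AlphaHom.IsBaseChange

theorem IsFrameHom.mem_I_iff (hα : IsFrameHom 𝓕 𝓕' 1 α)
    (hinj : Function.Injective (Ideal.quotientMap 𝓕'.I α (fun a ha => hα.mapI a ha))) (s : S) :
    α s ∈ 𝓕'.I ↔ s ∈ 𝓕.I := by
  refine ⟨fun h => ?_, hα.mapI s⟩
  rw [← Ideal.Quotient.eq_zero_iff_mem]
  exact hinj ((Ideal.Quotient.eq_zero_iff_mem.2 h).trans (map_zero _).symm)

theorem mem_ker_smul_of_basis {n : Type*} [Fintype n] {M N : Type*} [AddCommGroup M]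
    [AddCommGroup N] [Module S M] [Module S' N] (b : Module.Basis n S M) (b' : Module.Basis n S' N)
    (ι : M →ₛₗ[α] N) (hι : ∀ k, ι (b k) = b' k) {x : M} (hx : ι x = 0) :
    x ∈ RingHom.ker α • (⊤ : Submodule S M) := by
  rw [← b.sum_repr x] at hx ⊢
  simp only [map_sum, map_smulₛₗ, hι] at hx
  refine Submodule.sum_mem _ fun k _ => Submodule.smul_mem_smul ?_ Submodule.mem_top
  exact Fintype.linearIndependent_iff.1 b'.linearIndependent _ hx k

theorem exists_isBaseChange (hα : IsFrameHom 𝓕 𝓕' 1 α) (hsurj : Function.Surjective α)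
    (hR : Function.Bijective (Ideal.quotientMap 𝓕'.I α (fun a ha => hα.mapI a ha)))
    (hK : 𝓕.IsNilIdeal (RingHom.ker α)) (𝒳 : Window 𝓕) :
    ∃ (𝒳' : Window 𝓕') (ι : AlphaHom 1 α 𝒳 𝒳'), ι.IsBaseChange := by
  have := 𝓕.isLocal
  have := 𝓕'.isLocal
  have : RingHomSurjective α := ⟨hsurj⟩
  let b := Module.finBasis S 𝒳.P
  let n := Module.finrank S 𝒳.P
  let ι : 𝒳.P →ₛₗ[α] (Fin n → S') :=
    { toFun := fun x i => α (b.repr x i)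
      map_add' := fun x y => by ext i; simp
      map_smul' := fun s x => by ext i; simp }
  have hι : Function.Surjective ι := fun y => by
    choose x hx using fun i => hsurj (y i)
    refine ⟨b.equivFun.symm x, funext fun i => ?_⟩
    change α (b.equivFun (b.equivFun.symm x) i) = y i
    rw [LinearEquiv.apply_symm_apply, hx]
  have hker : ∀ x, ι x = 0 → x ∈ RingHom.ker α • (⊤ : Submodule S 𝒳.P) := fun x hx => by
    refine mem_ker_smul_of_basis b (Pi.basisFun S' (Fin n)) ι (fun k => ?_) hx
    ext i
    simp [ι, n, Finsupp.single_apply, Pi.basisFun_apply, Pi.single_apply, apply_ite α, eq_comm]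
  have hzero : ∀ x ∈ RingHom.ker α • (⊤ : Submodule S 𝒳.P), ι x = 0 := fun x hx =>
    semilinear_eq_zero_of_mem_ker_smul ι hx
  have hkerQ : RingHom.ker α • (⊤ : Submodule S 𝒳.P) ≤ 𝒳.Q :=
    (Submodule.smul_mono_left hK.le).trans 𝒳.isWindow.smul_le
  obtain ⟨θ, hθ⟩ := 𝓕.exists_f_eq_mul_f₁
  obtain ⟨F', hF'⟩ := exists_semilinear_descend hsurj 𝓕'.f ι hι (fun x => ι (𝒳.F x))
    (fun x y => by simp) (fun s x => by simp only [map_smulₛₗ, hα.commf])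
    (fun x hx => by
      have := hker x hx
      clear hx
      induction this using Submodule.smul_induction_on' with
      | smul a ha y _ =>
        have h1 := hθ ⟨a, hK.le ha⟩
        rw [← 𝓕.f₁Ext_of_mem] at h1
        rw [map_smulₛₗ, map_smulₛₗ, h1, map_mul, RingHom.mem_ker.1 (hK.f₁_mem a ha), mul_zero,
          zero_smul]
      | add x _ y _ hx hy => simp only [map_add, hx, hy, add_zero])
  let ιQ : 𝒳.Q →ₛₗ[α] (𝒳.Q.map ι) :=
    { toFun := fun x => ⟨ι x, Submodule.mem_map_of_mem x.2⟩
      map_add' := fun x y => by ext1; simp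
      map_smul' := fun s x => by ext1; simp }
  have hιQ : Function.Surjective ιQ := by
    rintro ⟨_, x, hx, rfl⟩
    exact ⟨⟨x, hx⟩, rfl⟩
  obtain ⟨F₁', hF₁'⟩ := exists_semilinear_descend hsurj 𝓕'.f ιQ hιQ (fun x => ι (𝒳.F₁ x))
    (fun x y => by simp) (fun s x => by simp only [map_smulₛₗ, hα.commf])
    (fun x hx => hzero _
      (𝒳.F₁_mem_smul_top hK.le hK.f₁_mem (hker x (congrArg Subtype.val hx)) x.2))
  have hI := hα.mem_I_iff hR.1
  have hle : 𝓕'.I • (⊤ : Submodule S' (Fin n → S')) ≤ 𝒳.Q.map ι := by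
    rw [Submodule.smul_le]
    intro a ha y _
    obtain ⟨a, rfl⟩ := hsurj a
    obtain ⟨x, rfl⟩ := hι y
    rw [← map_smulₛₗ]
    exact Submodule.mem_map_of_mem (𝒳.smul_mem_Q ((hI a).1 ha) x)
  have hw : IsWindow 𝓕' (𝒳.Q.map ι) F' F₁' := by
    refine ⟨hle, ?_, ?_, ?_⟩
    · obtain ⟨s, ⟨E⟩⟩ := 𝒳.isWindow.quot_free
      let q := Ideal.quotientMap 𝓕'.I α (fun a ha => hα.mapI a ha)
      obtain ⟨ψ, hψ⟩ := exists_semilinear_descend hsurj (RingHom.id S') ι hι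
        (fun x j => q (E (𝒳.Q.mkQ x) j))
        (fun x y => by ext j; simp)
        (fun s x => by
          ext j
          rw [map_smul, map_smul, Pi.smul_apply, Pi.smul_apply, Algebra.smul_def, map_mul,
            Algebra.smul_def]
          congr 1)
        (fun x hx => by
          have : 𝒳.Q.mkQ x = 0 := (Submodule.Quotient.mk_eq_zero _).2 (hkerQ (hker x hx))
          ext j
          simp [this])
      have hψs : Function.Surjective ψ := fun v => by
        choose u hu using fun j => hR.2 (v j)
        obtain ⟨x, hx⟩ := 𝒳.Q.mkQ_surjective (E.symm u)
        refine ⟨ι x, ?_⟩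
        rw [hψ, hx, LinearEquiv.apply_symm_apply]
        exact funext hu
      have hψk : LinearMap.ker ψ = 𝒳.Q.map ι := by
        ext y
        constructor
        · intro hy
          obtain ⟨x, rfl⟩ := hι y
          rw [LinearMap.mem_ker, hψ] at hy
          have h1 : E (𝒳.Q.mkQ x) = 0 := by
            ext j
            refine hR.1 ?_
            rw [Pi.zero_apply, map_zero]
            exact congrFun hy j
          rw [LinearEquiv.map_eq_zero_iff] at h1
          exact Submodule.mem_map_of_mem ((Submodule.Quotient.mk_eq_zero _).1 h1)
        · rintro ⟨x, hx, rfl⟩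
          have h1 : 𝒳.Q.mkQ x = 0 := (Submodule.Quotient.mk_eq_zero _).2 hx
          rw [LinearMap.mem_ker, hψ, h1]
          ext j
          simp
      exact ⟨s, ⟨(Submodule.quotEquivOfEq _ _ hψk.symm).trans
        (ψ.quotKerEquivOfSurjective hψs)⟩⟩
    · rintro ⟨a, ha⟩ y
      obtain ⟨a, rfl⟩ := hsurj a
      obtain ⟨x, rfl⟩ := hι y
      have h1 := hF₁' ⟨a • x, 𝒳.smul_mem_Q ((hI a).1 ha) x⟩
      rw [𝒳.F₁_smul ((hI a).1 ha), map_smulₛₗ] at h1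
      have h2 := hα.commf₁ ⟨a, (hI a).1 ha⟩ ha
      rw [one_mul] at h2
      rw [h2, hF', ← h1]
      congr 1
      ext1
      exact (map_smulₛₗ ι a x).symm
    · refine top_le_iff.1 fun y _ => ?_
      obtain ⟨x, rfl⟩ := hι y
      refine 𝒳.span_induction_F₁ ((Submodule.span S' (Set.range F₁')).comap ι) (fun x hx => ?_) x
      exact Submodule.subset_span ⟨_, hF₁' ⟨x, hx⟩⟩
  refine ⟨⟨Fin n → S', 𝒳.Q.map ι, F', F₁', hw⟩,
    ⟨ι, fun x hx => Submodule.mem_map_of_mem hx, hF', fun x h => ?_⟩, hι, ?_, hker⟩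
  · rw [one_smul]
    exact hF₁' x
  · rintro _ ⟨x, hx, rfl⟩
    exact ⟨x, hx, rfl⟩

theorem exists_window_isBaseChange (hα : IsFrameHom 𝓕 𝓕' 1 α) (hsurj : Function.Surjective α)
    (hR : Function.Bijective (Ideal.quotientMap 𝓕'.I α (fun a ha => hα.mapI a ha)))
    (𝒵 : Window 𝓕') :
    ∃ (𝒳 : Window 𝓕) (ι : AlphaHom 1 α 𝒳 𝒵), ι.IsBaseChange := by
  have := 𝓕.isLocal
  have := 𝓕'.isLocal
  obtain ⟨N⟩ := 𝒵.nonempty_normalDecomposition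
  have hI := hα.mem_I_iff hR.1
  obtain ⟨θ, hθ⟩ := 𝓕.exists_f_eq_mul_f₁
  have hf₁ : ∀ a (h : a ∈ 𝓕.I) (h' : α a ∈ 𝓕'.I), 𝓕'.f₁ ⟨α a, h'⟩ = α (𝓕.f₁ ⟨a, h⟩) :=
    fun a h h' => by
      have := hα.commf₁ ⟨a, h⟩ h'
      rwa [one_mul] at this
  have hθ' : ∀ a : 𝓕'.I, 𝓕'.f a = α θ * 𝓕'.f₁ a := by
    rintro ⟨a, ha⟩
    obtain ⟨a, rfl⟩ := hsurj a
    rw [hf₁ a ((hI a).1 ha), hα.commf, ← map_mul]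
    exact congrArg α (hθ ⟨a, _⟩)
  let ι : (Fin N.r ⊕ Fin N.s → S) →ₛₗ[α] 𝒵.P :=
    { toFun := fun x => ∑ k, α (x k) • N.e k
      map_add' := fun x y => by simp [add_smul, Finset.sum_add_distrib]
      map_smul' := fun s x => by simp [mul_smul, Finset.smul_sum] }
  have hrepr : ∀ x k, N.e.repr (ι x) k = α (x k) := fun x k =>
    congrFun (N.e.repr_sum_self fun k => α (x k)) k
  have hι : Function.Surjective ι := fun y => by
    choose x hx using fun k => hsurj (N.e.repr y k)
    refine ⟨x, N.e.repr.injective ?_⟩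
    ext k
    rw [hrepr, hx]
  have hker : ∀ x, ι x = 0 → x ∈ RingHom.ker α • (⊤ : Submodule S (Fin N.r ⊕ Fin N.s → S)) := fun x hx => by
    refine mem_ker_smul_of_basis (Pi.basisFun S _) N.e ι (fun k => ?_) hx
    refine N.e.repr.injective ?_
    ext i
    rw [hrepr]
    simp [Finsupp.single_apply, Pi.single_apply, apply_ite α, eq_comm]
  choose c hc using fun k => hι (N.c k)
  let q : (Fin N.r ⊕ Fin N.s → S) →ₗ[S] (Fin N.s → S ⧸ 𝓕.I) :=
    LinearMap.pi fun j => 𝓕.I.mkQ.comp (LinearMap.proj (Sum.inr j))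
  have hq : ∀ x, q x = 0 ↔ ∀ j, x (Sum.inr j) ∈ 𝓕.I := fun x => by
    rw [funext_iff]
    exact forall_congr' fun j => Submodule.Quotient.mk_eq_zero _
  let Q : Submodule S (Fin N.r ⊕ Fin N.s → S) := LinearMap.ker q
  have hQ : ∀ x : Q, ∀ j, x.1 (Sum.inr j) ∈ 𝓕.I := fun x => (hq x.1).1 x.2
  let F : (Fin N.r ⊕ Fin N.s → S) →ₛₗ[𝓕.f] (Fin N.r ⊕ Fin N.s → S) :=
    { toFun := fun x => ∑ i, (𝓕.f (x (Sum.inl i)) * θ) • c (Sum.inl i)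
        + ∑ j, 𝓕.f (x (Sum.inr j)) • c (Sum.inr j)
      map_add' := fun x y => by
        simp only [Pi.add_apply, map_add, add_mul, add_smul, Finset.sum_add_distrib]
        abel
      map_smul' := fun s x => by
        simp only [Pi.smul_apply, smul_eq_mul, map_mul, mul_smul, Finset.smul_sum, smul_add] }
  let F₁ : Q →ₛₗ[𝓕.f] (Fin N.r ⊕ Fin N.s → S) :=
    { toFun := fun x => ∑ i, 𝓕.f (x.1 (Sum.inl i)) • c (Sum.inl i)
        + ∑ j, 𝓕.f₁ ⟨x.1 (Sum.inr j), hQ x j⟩ • c (Sum.inr j)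
      map_add' := fun x y => by
        have h1 : ∀ j, 𝓕.f₁ ⟨(x + y).1 (Sum.inr j), hQ (x + y) j⟩
            = 𝓕.f₁ ⟨x.1 (Sum.inr j), hQ x j⟩ + 𝓕.f₁ ⟨y.1 (Sum.inr j), hQ y j⟩ := fun j =>
          𝓕.f₁.map_add ⟨x.1 (Sum.inr j), hQ x j⟩ ⟨y.1 (Sum.inr j), hQ y j⟩
        simp only [h1, add_smul, Finset.sum_add_distrib]
        simp only [Submodule.coe_add, Pi.add_apply, map_add, add_smul, Finset.sum_add_distrib]
        abel
      map_smul' := fun s x => by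
        have h1 : ∀ j, 𝓕.f₁ ⟨(s • x).1 (Sum.inr j), hQ (s • x) j⟩
            = 𝓕.f s * 𝓕.f₁ ⟨x.1 (Sum.inr j), hQ x j⟩ := fun j =>
          𝓕.f₁.map_smulₛₗ s ⟨x.1 (Sum.inr j), hQ x j⟩
        simp only [h1]
        simp only [Submodule.coe_smul, Pi.smul_apply, smul_eq_mul, map_mul, mul_smul,
          Finset.smul_sum, smul_add] }
  have hle : 𝓕.I • (⊤ : Submodule S (Fin N.r ⊕ Fin N.s → S)) ≤ Q := by
    rw [Submodule.smul_le]
    intro a ha x _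
    exact (hq _).2 fun j => Ideal.mul_mem_right _ _ ha
  have hspan : Submodule.span S (Set.range c) = ⊤ := by
    refine top_le_iff.1 (Submodule.le_of_le_smul_of_le_jacobson_bot (I := RingHom.ker α)
      Module.Finite.fg_top ?_ fun x _ => ?_)
    · rw [IsLocalRing.jacobson_eq_maximalIdeal _ bot_ne_top]
      exact IsLocalRing.le_maximalIdeal (RingHom.ker_ne_top α)
    · have h1 : ∀ y, ∃ z ∈ Submodule.span S (Set.range c), ι z = y := fun y => by
        have hy : y ∈ Submodule.span S' (Set.range N.c) := by
          rw [N.span_c]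
          exact Submodule.mem_top
        induction hy using Submodule.span_induction with
        | mem y hy =>
          obtain ⟨k, rfl⟩ := hy
          exact ⟨c k, Submodule.subset_span ⟨k, rfl⟩, hc k⟩
        | zero => exact ⟨0, zero_mem _, map_zero _⟩
        | add y y' _ _ hy hy' =>
          obtain ⟨z, hz, rfl⟩ := hy
          obtain ⟨z', hz', rfl⟩ := hy'
          exact ⟨z + z', add_mem hz hz', map_add _ _ _⟩
        | smul s y _ hy =>
          obtain ⟨z, hz, rfl⟩ := hy
          obtain ⟨s, rfl⟩ := hsurj s
          exact ⟨s • z, Submodule.smul_mem _ _ hz, map_smulₛₗ _ _ _⟩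
      obtain ⟨z, hz, hzx⟩ := h1 (ι x)
      have h2 : x = z + (x - z) := by abel
      rw [h2]
      exact Submodule.add_mem_sup hz (hker _ (by rw [map_sub, hzx, sub_self]))
  have hF₁s : ∀ (a : 𝓕.I) (x : (Fin N.r ⊕ Fin N.s → S)) (h : (a : S) • x ∈ Q), F₁ ⟨(a : S) • x, h⟩
      = 𝓕.f₁ a • F x := by
    intro a x h
    have h1 : ∀ j, 𝓕.f₁ ⟨((a : S) • x) (Sum.inr j), (hq _).1 h j⟩
        = 𝓕.f₁ a * 𝓕.f (x (Sum.inr j)) := fun j => by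
      rw [mul_comm, ← smul_eq_mul, ← 𝓕.f₁.map_smulₛₗ]
      congr 1
      ext1
      exact mul_comm _ _
    change ∑ i, 𝓕.f (((a : S) • x) (Sum.inl i)) • c (Sum.inl i)
        + ∑ j, 𝓕.f₁ ⟨((a : S) • x) (Sum.inr j), (hq _).1 h j⟩ • c (Sum.inr j)
      = 𝓕.f₁ a • (∑ i, (𝓕.f (x (Sum.inl i)) * θ) • c (Sum.inl i)
        + ∑ j, 𝓕.f (x (Sum.inr j)) • c (Sum.inr j))
    simp only [h1]
    simp only [smul_add, Finset.smul_sum, smul_smul, Pi.smul_apply, smul_eq_mul, map_mul, hθ]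
    congr 1
    refine Finset.sum_congr rfl fun i _ => ?_
    congr 1
    ring
  have hw : IsWindow 𝓕 Q F F₁ := by
    refine ⟨hle, ⟨N.s, ⟨q.quotKerEquivOfSurjective fun y => ?_⟩⟩, fun a x => hF₁s a x _, ?_⟩
    · choose x hx using fun j => Submodule.mkQ_surjective 𝓕.I (y j)
      exact ⟨Sum.elim 0 x, funext hx⟩
    · rw [← top_le_iff, ← hspan, Submodule.span_le]
      rintro _ ⟨i | j, rfl⟩
      · refine Submodule.subset_span ⟨⟨Pi.single (Sum.inl i) 1, (hq _).2 fun j => by simp⟩, ?_⟩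
        change ∑ i', 𝓕.f ((Pi.single (Sum.inl i) 1 : (Fin N.r ⊕ Fin N.s → S)) (Sum.inl i')) • c (Sum.inl i')
          + ∑ j, 𝓕.f₁ ⟨(Pi.single (Sum.inl i) 1 : (Fin N.r ⊕ Fin N.s → S)) (Sum.inr j), _⟩ • c (Sum.inr j) = _
        have h0 : ∀ h, 𝓕.f₁ ⟨0, h⟩ = 0 := fun _ => 𝓕.f₁.map_zero
        simp [Pi.single_apply, h0, apply_ite 𝓕.f, ite_smul]
      · obtain ⟨a, u, hu⟩ := 𝓕.exists_isUnit_f₁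
        have h1 : F (Pi.single (Sum.inr j) 1) = c (Sum.inr j) := by
          change ∑ i, (𝓕.f ((Pi.single (Sum.inr j) 1 : (Fin N.r ⊕ Fin N.s → S)) (Sum.inl i)) * θ) • c (Sum.inl i)
            + ∑ j', 𝓕.f ((Pi.single (Sum.inr j) 1 : (Fin N.r ⊕ Fin N.s → S)) (Sum.inr j')) • c (Sum.inr j') = _
          simp [Pi.single_apply, apply_ite 𝓕.f, ite_smul]
        have h2 := hF₁s a (Pi.single (Sum.inr j) 1)
          (hle (Submodule.smul_mem_smul a.2 Submodule.mem_top))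
        rw [h1, ← hu] at h2
        have h3 : c (Sum.inr j) = (↑u⁻¹ : S) • (u : S) • c (Sum.inr j) := by
          rw [smul_smul, Units.inv_mul, one_smul]
        rw [SetLike.mem_coe, h3, ← h2]
        exact Submodule.smul_mem _ _ (Submodule.subset_span ⟨_, rfl⟩)
  have hιQ : ∀ x, ι x ∈ 𝒵.Q ↔ x ∈ Q := fun x => by
    rw [N.mem_iff]
    refine Iff.trans ?_ (hq x).symm
    exact forall_congr' fun j => by rw [hrepr, hI]
  refine ⟨⟨(Fin N.r ⊕ Fin N.s → S), Q, F, F₁, hw⟩,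
    ⟨ι, fun x => (hιQ x).2, fun x => ?_, fun x h => ?_⟩, hι, ?_, hker⟩
  · change 𝒵.F (ι x) = ι (∑ i, (𝓕.f (x (Sum.inl i)) * θ) • c (Sum.inl i)
        + ∑ j, 𝓕.f (x (Sum.inr j)) • c (Sum.inr j))
    rw [N.F_eq_sum hθ']
    simp only [map_add, map_sum, map_smulₛₗ, hc, hrepr, hα.commf, map_mul]
    rfl
  · change 𝒵.F₁ ⟨ι x.1, h⟩ = (1 : S') • ι (∑ i, 𝓕.f (x.1 (Sum.inl i)) • c (Sum.inl i)
        + ∑ j, 𝓕.f₁ ⟨x.1 (Sum.inr j), hQ x j⟩ • c (Sum.inr j))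
    rw [one_smul, N.F₁_eq_sum]
    simp only [map_add, map_sum, map_smulₛₗ, hc, hrepr, hα.commf]
    congr 1
    refine Finset.sum_congr rfl fun j _ => ?_
    rw [hf₁ _ (hQ x j)]
    rfl
  · intro y hy
    obtain ⟨x, rfl⟩ := hι y
    exact ⟨x, (hιQ x).1 hy, rfl⟩

/-- The composition of a window morphism with an `α`-morphism. -/
def AlphaHom.precomp {𝒳 𝒴 : Window 𝓕} {𝒵 : Window 𝓕'} (κ : AlphaHom 1 α 𝒴 𝒵)
    (h : WindowHom 𝒳 𝒴) : AlphaHom 1 α 𝒳 𝒵 where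
  g := κ.g.comp h.g
  mapQ x hx := κ.mapQ _ (h.mapQ x hx)
  commF x := by simp [κ.commF, h.commF]
  commF₁ x hx := by
    have h1 := h.mapQ x x.2
    refine (κ.commF₁ ⟨h.g x, h1⟩ hx).trans ?_
    rw [h.commF₁ x h1]
    rfl

open CategoryTheory in
theorem isCrystalline_of_isBaseChange (hsurj : Function.Surjective α)
    (hK : 𝓕.IsNilIdeal (RingHom.ker α))
    (hbc : ∀ 𝒳 : Window 𝓕, ∃ (𝒳' : Window 𝓕') (ι : AlphaHom 1 α 𝒳 𝒳'), ι.IsBaseChange)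
    (hes : ∀ 𝒵 : Window 𝓕', ∃ (𝒳 : Window 𝓕) (ι : AlphaHom 1 α 𝒳 𝒵), ι.IsBaseChange) :
    IsCrystalline 𝓕 𝓕' 1 α := by
  choose B ι hι using hbc
  choose m hm _ using fun (𝒳 𝒴 : Window 𝓕) (h : WindowHom 𝒳 𝒴) =>
    (hι 𝒳).existsUnique_hom hsurj ((ι 𝒴).precomp h)
  have hm' : ∀ (𝒳 𝒴 : Window 𝓕) (h : WindowHom 𝒳 𝒴) x,
      (m 𝒳 𝒴 h).g ((ι 𝒳).g x) = (ι 𝒴).g (h.g x) := hm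
  let G : Window 𝓕 ⥤ Window 𝓕' :=
    { obj := B
      map := fun {𝒳 𝒴} h => m 𝒳 𝒴 h
      map_id := fun 𝒳 => (hι 𝒳).hom_ext fun x => hm' 𝒳 𝒳 (𝟙 𝒳) x
      map_comp := fun {𝒳 𝒴 𝒵} g h => (hι 𝒳).hom_ext fun x => by
        refine (hm' 𝒳 𝒵 (g ≫ h) x).trans ?_
        change (ι 𝒵).g (h.g (g.g x)) = (m 𝒴 𝒵 h).g ((m 𝒳 𝒴 g).g ((ι 𝒳).g x))
        rw [hm', hm'] }
  refine ⟨G, ι, hm', fun 𝒳 𝒵 g => (hι 𝒳).existsUnique_hom hsurj g, ?_⟩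
  have hfaith : G.Faithful := ⟨fun {𝒳 𝒴 g h} H => by
    refine (AlphaHom.IsBaseChange.existsUnique_lift hK (hι 𝒴) (m 𝒳 𝒴 g)).unique (hm' 𝒳 𝒴 g) fun x => ?_
    rw [show m 𝒳 𝒴 g = m 𝒳 𝒴 h from H]
    exact hm' 𝒳 𝒴 h x⟩
  have hfull : G.Full := ⟨fun {𝒳 𝒴} g' => by
    obtain ⟨g, hg⟩ := (AlphaHom.IsBaseChange.existsUnique_lift hK (hι 𝒴) g').exists
    exact ⟨g, (hι 𝒳).hom_ext fun x => (hm' 𝒳 𝒴 g x).trans (hg x).symm⟩⟩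
  have hess : G.EssSurj := ⟨fun 𝒵 => by
    obtain ⟨𝒳, κ, hκ⟩ := hes 𝒵
    obtain ⟨p, hp⟩ := ((hι 𝒳).existsUnique_hom hsurj κ).exists
    obtain ⟨r, hr⟩ := (hκ.existsUnique_hom hsurj (ι 𝒳)).exists
    refine ⟨𝒳, ⟨⟨p, r, (hι 𝒳).hom_ext fun x => ?_, hκ.hom_ext fun x => ?_⟩⟩⟩
    · change r.g (p.g ((ι 𝒳).g x)) = (ι 𝒳).g x
      rw [hp, hr]
    · change p.g (r.g (κ.g x)) = κ.g x
      rw [hr, hp]⟩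
  exact {}

end BaseChange

/-- Theorem 1 of the paper. Let `α : 𝓕 → 𝓕'` be a morphism of frames
inducing an isomorphism `R ≅ R'` and a surjection `S → S'` with nilpotent kernel `𝔞`
admitting a filtration `𝔞 = 𝔞₀ ⊇ 𝔞₁ ⊇ … ⊇ 𝔞_n = 0` (extended by `⊥` to all of `ℕ`)
with `f(𝔞ᵢ) ⊆ 𝔞ᵢ₊₁`, `f₁(𝔞ᵢ) ⊆ 𝔞ᵢ` and `f₁` elementwise nilpotent on `𝔞ᵢ/𝔞ᵢ₊₁`.
Then `α` is crystalline. (Note that `𝔞 ⊆ I` follows from the hypotheses.) -/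
theorem frame_morphism_crystalline {S S' : Type} [CommRing S] [CommRing S']
    (𝓕 : Frame S) (𝓕' : Frame S') (α : S →+* S')
    (hα : IsFrameHom 𝓕 𝓕' 1 α)
    (hsurj : Function.Surjective α)
    (hR : Function.Bijective
      (Ideal.quotientMap 𝓕'.I α (fun a ha => hα.mapI a ha)))
    (h𝔞I : RingHom.ker α ≤ 𝓕.I)
    (hnilp : ∃ m : ℕ, (RingHom.ker α) ^ m = ⊥)
    (𝔞 : ℕ → Ideal S) (h0 : 𝔞 0 = RingHom.ker α)
    (hanti : ∀ i, 𝔞 (i + 1) ≤ 𝔞 i)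
    (hfin : ∃ n : ℕ, 𝔞 n = ⊥)
    (hf : ∀ i, ∀ a ∈ 𝔞 i, 𝓕.f a ∈ 𝔞 (i + 1))
    (hf₁ : ∀ i, ∀ a, ∀ h : a ∈ 𝓕.I, a ∈ 𝔞 i → 𝓕.f₁ ⟨a, h⟩ ∈ 𝔞 i)
    (hnil : ∀ i, ∀ c : ℕ → S, c 0 ∈ 𝔞 i →
      (∀ j, ∃ h : c j ∈ 𝓕.I, c (j + 1) = 𝓕.f₁ ⟨c j, h⟩) →
      ∃ m, c m ∈ 𝔞 (i + 1)) :
    IsCrystalline 𝓕 𝓕' 1 α := by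
  have hK : 𝓕.IsNilIdeal (RingHom.ker α) := by
    rw [← h0] at h𝔞I ⊢
    exact 𝓕.isNilIdeal_of_filtration 𝔞 h𝔞I hanti hfin hf₁ hnil
  exact isCrystalline_of_isBaseChange hsurj hK (exists_isBaseChange hα hsurj hR hK)
    (exists_window_isBaseChange hα hsurj hR)
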